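/- Let s, t > 0 with s/t irrational, and let L = {(tc, sc) : c ∈ ℝ} ⊆ ℝ² (the line of slope s/t through the origin). Then the linear map f : ℝ² → ℝ, f(x, y) = sx − ty, induces an isomorphism of topological additive groups from ℝ²/(ℤ² + L) onto ℝ/(sℤ + tℤ), where both quotients carry the quotient topology. (Equivalently: the quotient of the 2-torus ℝ²/ℤ² by the image of the line L of irrational slope s/t is isomorphic, as a topological group, to the quasi-circle ℝ/(sℤ + tℤ).) -/

import Mathlib

/-- Continuous homomorphisms `f : G → H` and `g : H → G` respecting subgroups `A` and `B`, and
mutually inverse modulo these, induce mutually inverse continuous homomorphisms between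
`G ⧸ A` and `H ⧸ B`. -/
theorem QuotientAddGroup.exists_continuous_addEquiv {G H : Type*}
    [AddCommGroup G] [TopologicalSpace G] [AddCommGroup H] [TopologicalSpace H]
    {A : AddSubgroup G} {B : AddSubgroup H} (f : G →+ H) (g : H →+ G)
    (hf : Continuous f) (hg : Continuous g) (hAB : A ≤ B.comap f) (hBA : B ≤ A.comap g)
    (hgf : ∀ x, -g (f x) + x ∈ A) (hfg : ∀ y, -f (g y) + y ∈ B) :
    ∃ e : (G ⧸ A) ≃+ (H ⧸ B), Continuous e ∧ Continuous e.symm ∧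
      ∀ x : G, e (QuotientAddGroup.mk x) = QuotientAddGroup.mk (f x) := by
  refine ⟨{ QuotientAddGroup.map A B f hAB with
      invFun := QuotientAddGroup.map B A g hBA
      left_inv := ?_
      right_inv := ?_ }, ?_, ?_, fun x => rfl⟩
  · rintro ⟨x⟩
    exact QuotientAddGroup.eq.2 (hgf x)
  · rintro ⟨y⟩
    exact QuotientAddGroup.eq.2 (hfg y)
  · exact isQuotientMap_quot_mk.continuous_iff.2 (QuotientAddGroup.continuous_mk.comp hf)
  · exact isQuotientMap_quot_mk.continuous_iff.2 (QuotientAddGroup.continuous_mk.comp hg)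

/-- The linear map `f(x,y) = sx − ty` induces an isomorphism of topological additive
groups from `ℝ²/(ℤ² + L)` onto the quasi-circle `ℝ/(sℤ + tℤ)`, where
`L = {(tc, sc) : c ∈ ℝ}` is the line of slope `s/t` through the origin. -/
theorem torus_quotient_by_irrational_line_iso_quasicircle
    (s t : ℝ) (hs : 0 < s) (ht : 0 < t) (hirr : Irrational (s / t))
    (A : AddSubgroup (ℝ × ℝ))
    (hA : A = AddSubgroup.closure
      {p : ℝ × ℝ | p = (1, 0) ∨ p = (0, 1) ∨ ∃ c : ℝ, p = (t * c, s * c)})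
    (B : AddSubgroup ℝ)
    (hB : B = AddSubgroup.closure ({s, t} : Set ℝ)) :
    ∃ e : ((ℝ × ℝ) ⧸ A) ≃+ (ℝ ⧸ B),
      Continuous e ∧ Continuous e.symm ∧
      ∀ p : ℝ × ℝ, e (QuotientAddGroup.mk p) = QuotientAddGroup.mk (s * p.1 - t * p.2) := by
  have hs0 : s ≠ 0 := hs.ne'
  have hsB : s ∈ B := hB ▸ AddSubgroup.subset_closure (by simp)
  have htB : t ∈ B := hB ▸ AddSubgroup.subset_closure (by simp)
  have h10 : ((1, 0) : ℝ × ℝ) ∈ A := hA ▸ AddSubgroup.subset_closure (Or.inl rfl)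
  have h01 : ((0, 1) : ℝ × ℝ) ∈ A := hA ▸ AddSubgroup.subset_closure (Or.inr (Or.inl rfl))
  have hL (c : ℝ) : ((t * c, s * c) : ℝ × ℝ) ∈ A :=
    hA ▸ AddSubgroup.subset_closure (Or.inr (Or.inr ⟨c, rfl⟩))
  let f : ℝ × ℝ →+ ℝ :=
    { toFun := fun p => s * p.1 - t * p.2
      map_zero' := by simp
      map_add' := fun p q => by simp only [Prod.fst_add, Prod.snd_add]; ring }
  let g : ℝ →+ ℝ × ℝ :=
    { toFun := fun z => (z / s, 0)
      map_zero' := by simp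
      map_add' := fun y z => by simp [add_div] }
  refine QuotientAddGroup.exists_continuous_addEquiv f g ?_ ?_ ?_ ?_ ?_ ?_
  · change Continuous fun p : ℝ × ℝ => s * p.1 - t * p.2
    fun_prop
  · change Continuous fun z : ℝ => (z / s, (0 : ℝ))
    fun_prop
  · rw [hA, AddSubgroup.closure_le]
    rintro _ (rfl | rfl | ⟨c, rfl⟩)
    · simpa [f] using hsB
    · simpa [f] using htB
    · have : s * (t * c) - t * (s * c) = 0 := by ring
      simp [f, this]
  · rw [hB, AddSubgroup.closure_le]
    rintro _ (rfl | rfl)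
    · simpa [g, hs0] using h10
    · convert A.sub_mem (hL s⁻¹) h01 using 1
      simp [g, hs0, div_eq_mul_inv]
  · rintro ⟨x, y⟩
    convert hL (y / s) using 1
    ext
    · simp only [f, g, AddMonoidHom.coe_mk, ZeroHom.coe_mk, Prod.fst_add, Prod.fst_neg]
      field_simp
      ring
    · simp only [f, g, AddMonoidHom.coe_mk, ZeroHom.coe_mk, Prod.snd_add, Prod.snd_neg]
      field_simp
      ring
  · intro z
    have : -(s * (z / s)) + z = 0 := by field_simp; ring
    simp [f, g, this]
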